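/- arXiv:2004.03832 — 2 statements merged into one kernel-verified Lean document; each statement's English description precedes it below -/
import Mathlib

section
/- For every ν ∈ ℂ there exist constants N > 0 and C > 0 such that |J_ν(τ)| ≤ C τ^{−1/2} for all τ ≥ N; and if moreover ν ∉ ℤ, then (after possibly enlarging N and C) also |Y_ν(τ)| ≤ C τ^{−1/2} for all τ ≥ N. -/
open MeasureTheory Real Set

noncomputable section

/-- Bessel function of the first kind `J_ν(τ)`, defined by its power series,
using the principal branch of `(τ/2)^(ν+2k)`. -/
def besselJ (ν : ℂ) (τ : ℝ) : ℂ :=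
  ∑' k : ℕ, ((-1 : ℂ) ^ k / ((Nat.factorial k : ℂ) * Complex.Gamma (ν + k + 1))) *
    ((τ : ℂ) / 2) ^ (ν + 2 * (k : ℂ))

/-- Bessel function of the second kind (Neumann function) `Y_ν(τ)` for `ν ∉ ℤ`. -/
def besselY (ν : ℂ) (τ : ℝ) : ℂ :=
  (besselJ ν τ * Complex.cos (ν * (π : ℂ)) - besselJ (-ν) τ) / Complex.sin (ν * (π : ℂ))

/-- The index `ν` associated with the mass parameter `μ`. -/
def nuOf (μ : ℝ) : ℂ :=
  if μ ≤ 1 / 4 then ((Real.sqrt (1 - 4 * μ) / 2 : ℝ) : ℂ)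
  else Complex.I * ((Real.sqrt (4 * μ - 1) / 2 : ℝ) : ℂ)

/-- `e₊(t,ξ) = τ^{1/2} J_ν(τ)` with `τ = (1+t) r`, `r = |ξ|`. -/
def ePlus (ν : ℂ) (r t : ℝ) : ℂ :=
  (Real.sqrt ((1 + t) * r) : ℂ) * besselJ ν ((1 + t) * r)

/-- `e₋(t,ξ) = τ^{1/2} Y_ν(τ)` with `τ = (1+t) r`, `r = |ξ|`. -/
def eMinus (ν : ℂ) (r t : ℝ) : ℂ :=
  (Real.sqrt ((1 + t) * r) : ℂ) * besselY ν ((1 + t) * r)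

/-- `ė₊ = ∂ₜ e₊`. -/
def ePlusDot (ν : ℂ) (r t : ℝ) : ℂ := deriv (ePlus ν r) t

/-- `ė₋ = ∂ₜ e₋`. -/
def eMinusDot (ν : ℂ) (r t : ℝ) : ℂ := deriv (eMinus ν r) t

/-- The Fourier multiplier `E₀(t,t₀,ξ)` of the Klein–Gordon propagator. -/
def E0 (ν : ℂ) (r t t₀ : ℝ) : ℂ :=
  (ePlus ν r t * eMinusDot ν r t₀ - ePlusDot ν r t₀ * eMinus ν r t) /
    (ePlus ν r t₀ * eMinusDot ν r t₀ - ePlusDot ν r t₀ * eMinus ν r t₀)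

/-- The Fourier multiplier `E₁(t,t₀,ξ)` of the Klein–Gordon propagator. -/
def E1 (ν : ℂ) (r t t₀ : ℝ) : ℂ :=
  (ePlus ν r t₀ * eMinus ν r t - ePlus ν r t * eMinus ν r t₀) /
    (ePlus ν r t₀ * eMinusDot ν r t₀ - ePlusDot ν r t₀ * eMinus ν r t₀)

/-- `Ė₀ = ∂ₜ E₀` (derivative in the first time variable). -/
def E0dot (ν : ℂ) (r t t₀ : ℝ) : ℂ := deriv (fun s => E0 ν r s t₀) t

/-- `Ė₁ = ∂ₜ E₁` (derivative in the first time variable). -/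
def E1dot (ν : ℂ) (r t t₀ : ℝ) : ℂ := deriv (fun s => E1 ν r s t₀) t

/-- The Neumann function `Y₀(τ)` (logarithmic case `ν = 0`). -/
def besselY0 (τ : ℝ) : ℂ :=
  (2 / (π : ℂ)) * (Complex.log ((τ : ℂ) / 2) + (Real.eulerMascheroniConstant : ℂ)) * besselJ 0 τ +
    (2 / (π : ℂ)) * ∑' k : ℕ,
      ((-1 : ℂ) ^ ((k + 1) + 1) * ((harmonic (k + 1) : ℚ) : ℂ) /
          ((Nat.factorial (k + 1) : ℂ)) ^ 2) * ((τ : ℂ) / 2) ^ (2 * (k + 1))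

/-- `e₋(t,ξ) = τ^{1/2} Y₀(τ)` in the case `μ = 1/4`, `ν = 0`. -/
def eMinusZ (r t : ℝ) : ℂ :=
  (Real.sqrt ((1 + t) * r) : ℂ) * besselY0 ((1 + t) * r)

/-- `ė₋ = ∂ₜ e₋` in the case `μ = 1/4`. -/
def eMinusZDot (r t : ℝ) : ℂ := deriv (eMinusZ r) t

/-- `E₀(t,t₀,ξ)` in the case `μ = 1/4`, `ν = 0`. -/
def E0Z (r t t₀ : ℝ) : ℂ :=
  (ePlus 0 r t * eMinusZDot r t₀ - ePlusDot 0 r t₀ * eMinusZ r t) /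
    (ePlus 0 r t₀ * eMinusZDot r t₀ - ePlusDot 0 r t₀ * eMinusZ r t₀)

/-- `E₁(t,t₀,ξ)` in the case `μ = 1/4`, `ν = 0`. -/
def E1Z (r t t₀ : ℝ) : ℂ :=
  (ePlus 0 r t₀ * eMinusZ r t - ePlus 0 r t * eMinusZ r t₀) /
    (ePlus 0 r t₀ * eMinusZDot r t₀ - ePlusDot 0 r t₀ * eMinusZ r t₀)

/-- `Ė₀` in the case `μ = 1/4`. -/
def E0Zdot (r t t₀ : ℝ) : ℂ := deriv (fun s => E0Z r s t₀) t

/-- `Ė₁` in the case `μ = 1/4`. -/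
def E1Zdot (r t t₀ : ℝ) : ℂ := deriv (fun s => E1Z r s t₀) t


/-- The Taylor coefficients of the entire function `x ↦ x ^ (-ν / 2) * J_ν(2 √x)`. -/
def besselCoeff (ν : ℂ) (k : ℕ) : ℂ :=
  (-1 : ℂ) ^ k / ((Nat.factorial k : ℂ) * Complex.Gamma (ν + k + 1))

/-- The entire function `x ↦ x ^ (-ν / 2) * J_ν(2 √x)`. -/
def besselEntire (ν x : ℂ) : ℂ := ∑' k : ℕ, besselCoeff ν k * x ^ k

theorem summable_norm_besselCoeff_mul_pow (ν : ℂ) {R : ℝ} (hR : 0 ≤ R) :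
    Summable fun k : ℕ => ‖besselCoeff ν k‖ * R ^ k := by
  have hrad := Complex.radius_regularizedHGFunSeries_eq_top
    (a := (0 : Multiset ℂ)) (b := {ν + 1}) (by simp)
  have h := (Complex.regularizedHGFunSeries 0 {ν + 1}).summable_norm_mul_pow
    (r := ⟨R, hR⟩) (by rw [hrad]; exact ENNReal.coe_lt_top)
  refine h.congr fun k => ?_
  rw [Complex.regularizedHGFunSeries, FormalMultilinearSeries.ofScalars_norm]
  simp [Complex.regularizedHGFunCoeff, besselCoeff, add_right_comm]
  left
  rfl

theorem summable_besselCoeff_mul_pow (ν x : ℂ) :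
    Summable fun k : ℕ => besselCoeff ν k * x ^ k :=
  .of_norm (by simpa using summable_norm_besselCoeff_mul_pow ν (norm_nonneg x))

theorem succ_mul_besselCoeff_succ (ν : ℂ) (k : ℕ) :
    ((k : ℂ) + 1) * besselCoeff ν (k + 1) = -besselCoeff (ν + 1) k := by
  have h : (k : ℂ) + 1 ≠ 0 := Nat.cast_add_one_ne_zero k
  have e : ν + ((k : ℂ) + 1) + 1 = ν + 1 + k + 1 := by ring
  simp only [besselCoeff, Nat.factorial_succ, Nat.cast_mul, Nat.cast_succ, e, pow_succ]
  field_simp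

theorem besselCoeff_eq_mul_besselCoeff_add_one (ν : ℂ) (k : ℕ) :
    besselCoeff ν k = (ν + 1 + k) * besselCoeff (ν + 1) k := by
  have h := Complex.one_div_Gamma_eq_self_mul_one_div_Gamma_add_one (ν + k + 1)
  have e : ν + 1 + (k : ℂ) + 1 = ν + k + 1 + 1 := by ring
  rw [besselCoeff, besselCoeff, e, div_mul_eq_div_div, div_mul_eq_div_div, div_eq_mul_inv _
    (Complex.Gamma _), div_eq_mul_inv _ (Complex.Gamma (ν + k + 1 + 1)), h]
  ring

theorem hasDerivAt_besselEntire (ν x : ℂ) :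
    HasDerivAt (besselEntire ν) (-besselEntire (ν + 1) x) x := by
  set R : ℝ := ‖x‖ + 1
  have hR : 0 ≤ R := by positivity
  have hu : Summable fun k : ℕ => ‖besselCoeff ν k‖ * (k * R ^ (k - 1)) := by
    rw [← summable_nat_add_iff 1]
    refine (summable_norm_besselCoeff_mul_pow (ν + 1) hR).congr fun k => ?_
    rw [← norm_neg, ← succ_mul_besselCoeff_succ, norm_mul,
      show ‖(k : ℂ) + 1‖ = k + 1 by exact_mod_cast Complex.norm_natCast (k + 1)]
    push_cast
    ring
  have hx : x ∈ Metric.ball (0 : ℂ) R := by simp [R]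
  have hd : HasDerivAt (besselEntire ν)
      (∑' k : ℕ, besselCoeff ν k * (k * x ^ (k - 1))) x := by
    refine hasDerivAt_tsum_of_isPreconnected (t := Metric.ball 0 R) hu Metric.isOpen_ball
      (convex_ball _ _).isPreconnected (fun k y _ => (hasDerivAt_pow k y).const_mul _)
      (fun k y hy => ?_) hx (summable_besselCoeff_mul_pow ν x) hx
    rw [norm_mul, norm_mul, norm_pow, Complex.norm_natCast]
    gcongr
    simpa using (mem_ball_zero_iff.1 hy).le
  convert hd using 1
  have hs : Summable fun k : ℕ => besselCoeff ν k * (k * x ^ (k - 1)) := by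
    refine .of_norm_bounded hu fun k => ?_
    rw [norm_mul, norm_mul, norm_pow, Complex.norm_natCast]
    gcongr
    simp [R]
  rw [hs.tsum_eq_zero_add, besselEntire, ← tsum_neg]
  simp only [Nat.cast_zero, zero_mul, mul_zero, zero_add, Nat.add_sub_cancel, Nat.cast_succ]
  refine tsum_congr fun k => ?_
  rw [← neg_mul, ← succ_mul_besselCoeff_succ]
  ring

theorem mul_besselEntire_add_two (ν x : ℂ) :
    x * besselEntire (ν + 1 + 1) x = (ν + 1) * besselEntire (ν + 1) x - besselEntire ν x := by
  have h1 := summable_besselCoeff_mul_pow (ν + 1) x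
  have h0 := summable_besselCoeff_mul_pow ν x
  rw [besselEntire, besselEntire, besselEntire, ← tsum_mul_left, ← tsum_mul_left,
    ← (h1.mul_left (ν + 1)).tsum_sub h0, ((h1.mul_left (ν + 1)).sub h0).tsum_eq_zero_add,
    besselCoeff_eq_mul_besselCoeff_add_one ν 0]
  simp only [Nat.cast_zero, pow_zero, add_zero, mul_one, sub_self, zero_add]
  refine tsum_congr fun k => ?_
  rw [besselCoeff_eq_mul_besselCoeff_add_one ν (k + 1)]
  have := succ_mul_besselCoeff_succ (ν + 1) k
  push_cast
  linear_combination x ^ (k + 1) * this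

theorem besselJ_eq_cpow_mul_besselEntire (ν : ℂ) {τ : ℝ} (hτ : 0 < τ) :
    besselJ ν τ = ((τ / 2 : ℝ) : ℂ) ^ ν * besselEntire ν ((τ : ℂ) ^ 2 / 4) := by
  have h : (τ : ℂ) / 2 ≠ 0 := by simp [hτ.ne']
  rw [besselJ, besselEntire, ← tsum_mul_left]
  refine tsum_congr fun k => ?_
  rw [Complex.cpow_add _ _ h, show (2 : ℂ) * k = ((2 * k : ℕ) : ℂ) by push_cast; ring,
    Complex.cpow_natCast, pow_mul, besselCoeff]
  push_cast
  rw [show ((τ : ℂ) / 2) ^ 2 = (τ : ℂ) ^ 2 / 4 by ring]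
  ring

theorem hasDerivAt_besselEntire_sq_div_four (ν : ℂ) (τ : ℝ) :
    HasDerivAt (fun t : ℝ => besselEntire ν ((t : ℂ) ^ 2 / 4))
      (-((τ : ℂ) / 2 * besselEntire (ν + 1) ((τ : ℂ) ^ 2 / 4))) τ := by
  have h1 : HasDerivAt (fun z : ℂ => z ^ 2 / 4) ((τ : ℂ) / 2) (τ : ℂ) := by
    refine ((hasDerivAt_pow 2 (τ : ℂ)).div_const 4).congr_deriv ?_
    push_cast
    ring
  have h2 := ((hasDerivAt_besselEntire ν _).comp (τ : ℂ) h1).comp_ofReal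
  rwa [neg_mul, mul_comm] at h2

theorem hasDerivAt_ofReal_cpow_div (s : ℂ) {τ : ℝ} (hτ : 0 < τ) :
    HasDerivAt (fun t : ℝ => (t : ℂ) ^ s) (s * (τ : ℂ) ^ s / τ) τ := by
  have h : HasDerivAt (fun z : ℂ => z ^ s) (s * (τ : ℂ) ^ (s - 1)) (τ : ℂ) := by
    simpa using (hasDerivAt_id (τ : ℂ)).cpow_const (c := s) (by simp [hτ])
  convert h.comp_ofReal using 1
  rw [Complex.cpow_sub _ _ (by exact_mod_cast hτ.ne'), Complex.cpow_one]
  ring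

/-- Solutions of `v'' = -(1 + c / τ ^ 2) v` are bounded on `[1, ∞)`. -/
theorem exists_norm_le_of_hasDerivAt_neg_one_add_div_sq {v w : ℝ → ℂ} {c : ℂ}
    (hv : ∀ τ, 0 < τ → HasDerivAt v (w τ) τ)
    (hw : ∀ τ : ℝ, 0 < τ → HasDerivAt w (-v τ - c / (τ : ℂ) ^ 2 * v τ) τ) :
    ∃ B, ∀ τ, 1 ≤ τ → ‖v τ‖ ≤ B := by
  set h : ℝ → ℝ := fun τ => (‖v τ‖ ^ 2 + ‖w τ‖ ^ 2) * Real.exp (‖c‖ / τ) with hh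
  have hd : ∀ τ : ℝ, 0 < τ → ∃ d ≤ 0, HasDerivAt h d τ := by
    intro τ hτ
    have hexp : HasDerivAt (fun t : ℝ => Real.exp (‖c‖ / t))
        (Real.exp (‖c‖ / τ) * (‖c‖ * -(τ ^ 2)⁻¹)) τ := by
      simpa only [div_eq_mul_inv] using ((hasDerivAt_inv hτ.ne').const_mul ‖c‖).exp
    refine ⟨_, ?_, (((hv τ hτ).norm_sq).add ((hw τ hτ).norm_sq)).mul hexp⟩
    have h1 := abs_real_inner_le_norm (w τ) (c / (τ : ℂ) ^ 2 * v τ)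
    have h2 : ‖c / (τ : ℂ) ^ 2 * v τ‖ = ‖c‖ * (τ ^ 2)⁻¹ * ‖v τ‖ := by
      simp [div_eq_mul_inv]
    rw [h2] at h1
    have h3 := neg_le_of_abs_le h1
    have h4 : 0 ≤ ‖c‖ * (τ ^ 2)⁻¹ := by positivity
    have h5 := mul_nonneg h4 (sq_nonneg (‖v τ‖ - ‖w τ‖))
    rw [inner_sub_right, inner_neg_right, real_inner_comm (v τ) (w τ)]
    have h6 : (2 * inner ℝ (v τ) (w τ) +
        2 * (-inner ℝ (v τ) (w τ) - inner ℝ (w τ) (c / (τ : ℂ) ^ 2 * v τ))) -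
        (‖v τ‖ ^ 2 + ‖w τ‖ ^ 2) * (‖c‖ * (τ ^ 2)⁻¹) ≤ 0 := by
      nlinarith
    have h7 := mul_nonpos_of_nonpos_of_nonneg h6 (Real.exp_pos (‖c‖ / τ)).le
    simp only [Pi.add_apply]
    linarith
  have hanti : AntitoneOn h (Ici 1) := by
    have hpos : ∀ τ ∈ Ici (1 : ℝ), 0 < τ := fun τ hτ => zero_lt_one.trans_le hτ
    refine antitoneOn_of_deriv_nonpos (convex_Ici 1) (fun τ hτ => ?_) (fun τ hτ => ?_)
      fun τ hτ => ?_
    · obtain ⟨d, -, H⟩ := hd τ (hpos τ hτ)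
      exact H.continuousAt.continuousWithinAt
    · obtain ⟨d, -, H⟩ := hd τ (hpos τ (interior_subset hτ))
      exact H.differentiableAt.differentiableWithinAt
    · obtain ⟨d, hd0, H⟩ := hd τ (hpos τ (interior_subset hτ))
      exact H.deriv.trans_le hd0
  refine ⟨√(h 1), fun τ hτ => Real.le_sqrt_of_sq_le ?_⟩
  have hle : h τ ≤ h 1 := hanti self_mem_Ici hτ hτ
  have hone : 1 ≤ Real.exp (‖c‖ / τ) := Real.one_le_exp (by positivity)
  refine le_trans ?_ hle
  simp only [hh]
  nlinarith [sq_nonneg ‖v τ‖, sq_nonneg ‖w τ‖]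

theorem exists_norm_cpow_mul_besselEntire_le (ν : ℂ) :
    ∃ B, ∀ τ : ℝ, 1 ≤ τ →
      ‖(τ : ℂ) ^ (ν + 1 / 2) * besselEntire ν ((τ : ℂ) ^ 2 / 4)‖ ≤ B := by
  set s : ℂ := ν + 1 / 2 with hs
  let p : ℝ → ℂ := fun τ => (τ : ℂ) ^ s
  let G : ℂ → ℝ → ℂ := fun μ τ => besselEntire μ ((τ : ℂ) ^ 2 / 4)
  have hp : ∀ τ : ℝ, 0 < τ → HasDerivAt p (s * p τ / τ) τ :=
    fun τ hτ => hasDerivAt_ofReal_cpow_div s hτ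
  have hG : ∀ (μ : ℂ) (τ : ℝ), HasDerivAt (G μ) (-((τ : ℂ) / 2 * G (μ + 1) τ)) τ :=
    hasDerivAt_besselEntire_sq_div_four
  have hT : ∀ τ : ℝ, HasDerivAt (fun t : ℝ => (t : ℂ)) 1 τ :=
    fun τ => (hasDerivAt_id (τ : ℂ)).comp_ofReal
  refine exists_norm_le_of_hasDerivAt_neg_one_add_div_sq (v := fun τ => p τ * G ν τ)
    (w := fun τ => s * p τ / τ * G ν τ + p τ * -((τ : ℂ) / 2 * G (ν + 1) τ))
    (c := -(s * (s - 1))) (fun τ hτ => (hp τ hτ).mul (hG ν τ)) fun τ hτ => ?_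
  have hτ0 : (τ : ℂ) ≠ 0 := by exact_mod_cast hτ.ne'
  refine HasDerivAt.congr_deriv (((((hp τ hτ).const_mul s).div (hT τ) hτ0).mul (hG ν τ)).add
    ((hp τ hτ).mul (((hT τ).div_const 2).mul (hG (ν + 1) τ)).neg)) ?_
  simp only [Pi.div_apply]
  have hrec : (τ : ℂ) ^ 2 / 4 * G (ν + 1 + 1) τ = (ν + 1) * G (ν + 1) τ - G ν τ :=
    mul_besselEntire_add_two ν _
  have hν : ν = s - 1 / 2 := by rw [hs]; ring
  generalize G (ν + 1 + 1) τ = g2 at *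
  generalize G (ν + 1) τ = g1 at *
  generalize G ν τ = g0 at *
  rw [hν] at hrec
  field_simp
  linear_combination (4 * (τ : ℂ) ^ 2 * p τ) * hrec

theorem exists_norm_besselJ_le (ν : ℂ) :
    ∃ C > (0 : ℝ), ∀ τ : ℝ, 1 ≤ τ → ‖besselJ ν τ‖ ≤ C * τ ^ (-(1 / 2) : ℝ) := by
  obtain ⟨B, hB⟩ := exists_norm_cpow_mul_besselEntire_le ν
  have hB0 : 0 ≤ B := (norm_nonneg _).trans (hB 1 le_rfl)
  refine ⟨(2⁻¹ : ℝ) ^ ν.re * (B + 1), by positivity, fun τ hτ => ?_⟩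
  have hτ0 : 0 < τ := zero_lt_one.trans_le hτ
  have h := hB τ hτ
  rw [norm_mul, Complex.norm_cpow_eq_rpow_re_of_pos hτ0] at h
  rw [besselJ_eq_cpow_mul_besselEntire ν hτ0, norm_mul,
    Complex.norm_cpow_eq_rpow_re_of_pos (by positivity), div_eq_inv_mul,
    Real.mul_rpow (by norm_num) hτ0.le]
  have hre : (ν + 1 / 2).re = ν.re + 1 / 2 := by simp
  have hsplit : τ ^ ν.re = τ ^ (ν + 1 / 2).re * τ ^ (-(1 / 2) : ℝ) := by
    rw [← Real.rpow_add hτ0, hre]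
    ring_nf
  rw [hsplit]
  calc _ = (2⁻¹ : ℝ) ^ ν.re * (τ ^ (ν + 1 / 2).re * ‖besselEntire ν ((τ : ℂ) ^ 2 / 4)‖) *
        τ ^ (-(1 / 2) : ℝ) := by ring
    _ ≤ _ := by
      gcongr
      linarith

/-- large-argument bounds `|J_ν(τ)| ≤ C τ^{-1/2}` for `τ ≥ N`, and,
for `ν ∉ ℤ` (after possibly enlarging `N` and `C`), also `|Y_ν(τ)| ≤ C τ^{-1/2}`. -/
theorem stmt2 (ν : ℂ) :
    (∃ N > (0 : ℝ), ∃ C > (0 : ℝ), ∀ τ : ℝ, N ≤ τ →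
        ‖besselJ ν τ‖ ≤ C * τ ^ (-(1 / 2) : ℝ)) ∧
    ((∀ n : ℤ, ν ≠ (n : ℂ)) →
      ∃ N > (0 : ℝ), ∃ C > (0 : ℝ), ∀ τ : ℝ, N ≤ τ →
        ‖besselJ ν τ‖ ≤ C * τ ^ (-(1 / 2) : ℝ) ∧
        ‖besselY ν τ‖ ≤ C * τ ^ (-(1 / 2) : ℝ)) := by
  obtain ⟨C, hC, hJ⟩ := exists_norm_besselJ_le ν
  refine ⟨⟨1, one_pos, C, hC, hJ⟩, fun _ => ?_⟩
  obtain ⟨C', hC', hJ'⟩ := exists_norm_besselJ_le (-ν)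
  set D : ℝ := (C * ‖Complex.cos (ν * (π : ℂ))‖ + C') / ‖Complex.sin (ν * (π : ℂ))‖ with hD
  have hD0 : 0 ≤ D := by positivity
  refine ⟨1, one_pos, C + D, by positivity, fun τ hτ => ?_⟩
  have hp : 0 ≤ τ ^ (-(1 / 2) : ℝ) := Real.rpow_nonneg (zero_le_one.trans hτ) _
  refine ⟨(hJ τ hτ).trans (by gcongr; linarith), ?_⟩
  have hnum : ‖besselJ ν τ * Complex.cos (ν * (π : ℂ)) - besselJ (-ν) τ‖ ≤
      (C * ‖Complex.cos (ν * (π : ℂ))‖ + C') * τ ^ (-(1 / 2) : ℝ) := by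
    refine (norm_sub_le _ _).trans ?_
    rw [norm_mul]
    have := mul_le_mul_of_nonneg_right (hJ τ hτ) (norm_nonneg (Complex.cos (ν * (π : ℂ))))
    linarith [hJ' τ hτ]
  calc ‖besselY ν τ‖ ≤ D * τ ^ (-(1 / 2) : ℝ) := by
        rw [besselY, norm_div, hD, div_mul_eq_mul_div]
        gcongr
    _ ≤ (C + D) * τ ^ (-(1 / 2) : ℝ) := by
        gcongr
        linarith

end
end

section
/- Let μ = 1/4 (so ν = 0), let d ≥ 1 and let R > 0. Then there exists C > 0 such that for all t ≥ 0 and ξ ∈ ℝ^d \ {0} with τ := (1+t)|ξ| ≤ R, one has |e_+(t,ξ)| ≤ C τ^{1/2}, |e_−(t,ξ)| ≤ C τ^{1/2}(1 + |log τ|), |ė_+(t,ξ)| ≤ C |ξ| τ^{−1/2} and |ė_−(t,ξ)| ≤ C |ξ| τ^{−1/2}(1 + |log τ|). -/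
open MeasureTheory Real Set

noncomputable section

theorem differentiable_tsum_mul_pow {a : ℕ → ℂ} (ha : ∀ k, ‖a k‖ ≤ 1 / (k.factorial : ℝ)) :
    Differentiable ℂ fun z : ℂ => ∑' k : ℕ, a k * z ^ k := by
  intro z
  have hball : DifferentiableOn ℂ (fun w : ℂ => ∑' k : ℕ, a k * w ^ k)
      (Metric.ball 0 (‖z‖ + 1)) := by
    refine Complex.differentiableOn_tsum_of_summable_norm
      (Real.summable_pow_div_factorial (‖z‖ + 1)) (fun k => by fun_prop) Metric.isOpen_ball ?_
    intro k w hw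
    rw [mem_ball_zero_iff] at hw
    rw [norm_mul, norm_pow, div_eq_mul_one_div, mul_comm]
    gcongr
    exact ha k
  exact hball.differentiableAt (Metric.isOpen_ball.mem_nhds (by simp))

theorem besselJ_zero_eq_tsum (τ : ℝ) :
    besselJ 0 τ = ∑' k : ℕ, (-1 : ℂ) ^ k / ((k.factorial : ℂ)) ^ 2 * (((τ : ℂ) / 2) ^ 2) ^ k := by
  refine tsum_congr fun k => ?_
  have hexp : (0 : ℂ) + 2 * (k : ℂ) = ((2 * k : ℕ) : ℂ) := by push_cast; ring
  rw [hexp, Complex.cpow_natCast, zero_add, Complex.Gamma_nat_eq_factorial, pow_mul,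
    sq (k.factorial : ℂ)]

theorem exists_differentiable_eq_besselJ_zero :
    ∃ J : ℂ → ℂ, Differentiable ℂ J ∧ ∀ τ : ℝ, besselJ 0 τ = J τ := by
  have hdiff := differentiable_tsum_mul_pow
    (a := fun k => (-1 : ℂ) ^ k / ((k.factorial : ℂ)) ^ 2) fun k => by
      have hk : (1 : ℝ) ≤ k.factorial := by exact_mod_cast k.factorial_pos
      simp only [norm_div, norm_pow, norm_neg, norm_one, one_pow, Complex.norm_natCast]
      gcongr
      nlinarith
  exact ⟨fun z => ∑' k : ℕ, (-1 : ℂ) ^ k / ((k.factorial : ℂ)) ^ 2 * ((z / 2) ^ 2) ^ k,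
    hdiff.comp (by fun_prop : Differentiable ℂ fun z : ℂ => (z / 2) ^ 2), besselJ_zero_eq_tsum⟩

theorem harmonic_le_self (n : ℕ) : harmonic n ≤ n := by
  induction n with
  | zero => simp
  | succ n ih =>
    rw [harmonic_succ]
    have h : ((n + 1 : ℕ) : ℚ)⁻¹ ≤ 1 :=
      inv_le_one_of_one_le₀ (by push_cast; linarith [n.cast_nonneg (α := ℚ)])
    push_cast at h ⊢
    linarith

theorem norm_besselY0_coeff_le (k : ℕ) :
    ‖(-1 : ℂ) ^ ((k + 1) + 1) * ((harmonic (k + 1) : ℚ) : ℂ) /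
      (((k + 1).factorial : ℂ)) ^ 2‖ ≤ 1 / (k.factorial : ℝ) := by
  have hk : (0 : ℝ) < k.factorial := by exact_mod_cast k.factorial_pos
  have hk1 : (1 : ℝ) ≤ k.factorial := by exact_mod_cast k.factorial_pos
  have hH : ((harmonic (k + 1) : ℚ) : ℝ) ≤ (k : ℝ) + 1 := by
    exact_mod_cast harmonic_le_self (k + 1)
  have hH0 : (0 : ℝ) ≤ ((harmonic (k + 1) : ℚ) : ℝ) := by
    exact_mod_cast (harmonic_pos k.succ_ne_zero).le
  have hnorm : ‖((harmonic (k + 1) : ℚ) : ℂ)‖ = ((harmonic (k + 1) : ℚ) : ℝ) := by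
    rw [← Complex.ofReal_ratCast, Complex.norm_real, Real.norm_of_nonneg hH0]
  rw [norm_div, norm_mul, hnorm]
  simp only [norm_pow, norm_neg, norm_one, one_pow, Complex.norm_natCast, one_mul]
  rw [Nat.factorial_succ, div_le_div_iff₀ (by positivity) hk]
  push_cast
  have hk0 : (0 : ℝ) ≤ k := k.cast_nonneg
  calc _ ≤ ((k : ℝ) + 1) * k.factorial := by gcongr
    _ ≤ ((k : ℝ) + 1) * k.factorial * (((k : ℝ) + 1) * k.factorial) :=
      le_mul_of_one_le_right (by positivity) (one_le_mul_of_one_le_of_one_le (by linarith) hk1)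
    _ = _ := by ring

theorem exists_differentiable_eq_besselY0_series :
    ∃ S : ℂ → ℂ, Differentiable ℂ S ∧ ∀ τ : ℝ, besselY0 τ =
      (2 / (π : ℂ)) * (Complex.log ((τ : ℂ) / 2) + (Real.eulerMascheroniConstant : ℂ)) *
        besselJ 0 τ + (2 / (π : ℂ)) * S τ := by
  have hdiff := differentiable_tsum_mul_pow norm_besselY0_coeff_le
  refine ⟨fun z => (z / 2) ^ 2 * ∑' k : ℕ, ((-1 : ℂ) ^ ((k + 1) + 1) *
      ((harmonic (k + 1) : ℚ) : ℂ) / (((k + 1).factorial : ℂ)) ^ 2) * ((z / 2) ^ 2) ^ k,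
    Differentiable.mul (by fun_prop)
      (hdiff.comp (by fun_prop : Differentiable ℂ fun z : ℂ => (z / 2) ^ 2)), fun τ => ?_⟩
  rw [besselY0]
  congr 2
  beta_reduce
  rw [← tsum_mul_left]
  refine tsum_congr fun k => ?_
  rw [pow_mul, pow_succ (((τ : ℂ) / 2) ^ 2) k]
  ring

theorem exists_norm_le_and_norm_deriv_le {f : ℂ → ℂ} (hf : Differentiable ℂ f) (R : ℝ) :
    ∃ M : ℝ, ∀ z, ‖z‖ ≤ R → ‖f z‖ ≤ M ∧ ‖deriv f z‖ ≤ M := by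
  have hcont : Continuous (deriv f) := (hf.contDiff (n := 1)).continuous_deriv le_rfl
  obtain ⟨M₁, h₁⟩ := (isCompact_closedBall (0 : ℂ) R).exists_bound_of_continuousOn
    hf.continuous.continuousOn
  obtain ⟨M₂, h₂⟩ := (isCompact_closedBall (0 : ℂ) R).exists_bound_of_continuousOn
    hcont.continuousOn
  refine ⟨max M₁ M₂, fun z hz => ?_⟩
  have hz' : z ∈ Metric.closedBall (0 : ℂ) R := by simpa using hz
  exact ⟨(h₁ z hz').trans (le_max_left _ _), (h₂ z hz').trans (le_max_right _ _)⟩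

theorem norm_deriv_sqrt_mul_le {y : ℝ → ℂ} {y' : ℂ} {r t A B : ℝ} (hr : 0 < r)
    (hτ : 0 < (1 + t) * r) (hy : HasDerivAt y y' ((1 + t) * r))
    (hA : ‖y ((1 + t) * r)‖ ≤ A) (hB : (1 + t) * r * ‖y'‖ ≤ B) :
    ‖deriv (fun s => (√((1 + s) * r) : ℂ) * y ((1 + s) * r)) t‖ ≤
      (A + B) * r * ((1 + t) * r) ^ (-(1 : ℝ) / 2) := by
  have hlin : HasDerivAt (fun s : ℝ => (1 + s) * r) r t := by
    simpa using ((hasDerivAt_id t).const_add 1).mul_const r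
  have hsqrt := ((hlin.sqrt hτ.ne').ofReal_comp).mul (hy.scomp t hlin)
  have hd := hsqrt.deriv
  simp only [Function.comp_apply] at hd
  have hfun : (fun s => (√((1 + s) * r) : ℂ) * y ((1 + s) * r)) =
    (fun s => ((√((1 + s) * r) : ℝ) : ℂ)) * (y ∘ fun s => (1 + s) * r) := rfl
  rw [hfun, hd]
  set τ := (1 + t) * r
  have hpow : τ ^ (-(1 : ℝ) / 2) = (√τ)⁻¹ := by
    rw [neg_div, Real.rpow_neg hτ.le, Real.sqrt_eq_rpow]
  have hs : 0 < √τ := Real.sqrt_pos.2 hτ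
  have hss : √τ = τ * (√τ)⁻¹ := by
    rw [eq_mul_inv_iff_mul_eq₀ hs.ne', Real.mul_self_sqrt hτ.le]
  rw [hpow]
  have h1 : ‖((r / (2 * √τ) : ℝ) : ℂ) * y τ‖ ≤ A * r * (√τ)⁻¹ := by
    rw [norm_mul, Complex.norm_real, Real.norm_of_nonneg (by positivity)]
    have hA0 : 0 ≤ ‖y τ‖ := norm_nonneg _
    calc r / (2 * √τ) * ‖y τ‖ = (1 / 2) * (‖y τ‖ * r * (√τ)⁻¹) := by field_simp
      _ ≤ 1 * (‖y τ‖ * r * (√τ)⁻¹) := by gcongr; norm_num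
      _ ≤ A * r * (√τ)⁻¹ := by rw [one_mul]; gcongr
  have h2 : ‖((√τ : ℝ) : ℂ) * (r • y')‖ ≤ B * r * (√τ)⁻¹ := by
    rw [norm_mul, Complex.norm_real, Real.norm_of_nonneg hs.le, norm_smul,
      Real.norm_of_nonneg hr.le]
    calc √τ * (r * ‖y'‖) = (τ * ‖y'‖) * r * (√τ)⁻¹ := by
          nth_rewrite 1 [hss]; ring
      _ ≤ B * r * (√τ)⁻¹ := by gcongr
  calc _ ≤ _ := norm_add_le _ _
    _ ≤ _ := add_le_add h1 h2
    _ = _ := by ring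

theorem norm_two_div_pi_le_one : ‖(2 / (π : ℂ))‖ ≤ 1 := by
  rw [norm_div, Complex.norm_real, Real.norm_of_nonneg Real.pi_pos.le, Complex.norm_ofNat,
    div_le_one Real.pi_pos]
  exact Real.two_le_pi

theorem norm_log_half_add_eulerMascheroni_le {τ : ℝ} (hτ : 0 < τ) :
    ‖Complex.log ((τ : ℂ) / 2) + (Real.eulerMascheroniConstant : ℂ)‖ ≤ |Real.log τ| + 2 := by
  have hcast : Complex.log ((τ : ℂ) / 2) = ((Real.log τ - Real.log 2 : ℝ) : ℂ) := by
    rw [← Real.log_div hτ.ne' two_ne_zero, Complex.ofReal_log (by positivity)]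
    push_cast
    rfl
  rw [hcast, ← Complex.ofReal_add, Complex.norm_real, Real.norm_eq_abs, abs_le]
  have h1 := Real.log_two_gt_d9
  have h2 := Real.log_two_lt_d9
  have h3 := Real.one_half_lt_eulerMascheroniConstant
  have h4 := Real.eulerMascheroniConstant_lt_two_thirds
  constructor <;> linarith [le_abs_self (Real.log τ), neg_abs_le (Real.log τ)]

theorem hasDerivAt_log_half {τ : ℝ} (hτ : 0 < τ) :
    HasDerivAt (fun s : ℝ => Complex.log ((s : ℂ) / 2)) ((τ : ℂ)⁻¹) τ := by
  have hτ' : (τ : ℂ) ≠ 0 := by exact_mod_cast hτ.ne'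
  have hmem : (τ : ℂ) / 2 ∈ Complex.slitPlane := by
    have := Complex.ofReal_mem_slitPlane.2 (half_pos hτ)
    push_cast at this
    exact this
  have h := (((hasDerivAt_id (τ : ℂ)).div_const 2).clog hmem).comp_ofReal
  have hval : (1 : ℂ) / 2 / ((τ : ℂ) / 2) = (τ : ℂ)⁻¹ := by field_simp
  exact hval ▸ h

/-- case `μ = 1/4` (`ν = 0`): for `R > 0` there is `C > 0` such that
for all `t ≥ 0`, `ξ ≠ 0` with `τ = (1+t)|ξ| ≤ R`:
`|e₊| ≤ C τ^{1/2}`, `|e₋| ≤ C τ^{1/2}(1+|log τ|)`, `|ė₊| ≤ C |ξ| τ^{−1/2}`,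
`|ė₋| ≤ C |ξ| τ^{−1/2}(1+|log τ|)`. -/
theorem stmt7 (d : ℕ) (hd : 1 ≤ d) (R : ℝ) (hR : 0 < R) :
    ∃ C > (0 : ℝ), ∀ t : ℝ, 0 ≤ t →
      ∀ ξ : EuclideanSpace ℝ (Fin d), ξ ≠ 0 → (1 + t) * ‖ξ‖ ≤ R →
        ‖ePlus 0 ‖ξ‖ t‖ ≤ C * ((1 + t) * ‖ξ‖) ^ ((1 : ℝ) / 2) ∧
        ‖eMinusZ ‖ξ‖ t‖ ≤
          C * ((1 + t) * ‖ξ‖) ^ ((1 : ℝ) / 2) * (1 + |Real.log ((1 + t) * ‖ξ‖)|) ∧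
        ‖ePlusDot 0 ‖ξ‖ t‖ ≤ C * ‖ξ‖ * ((1 + t) * ‖ξ‖) ^ (-(1 : ℝ) / 2) ∧
        ‖eMinusZDot ‖ξ‖ t‖ ≤
          C * ‖ξ‖ * ((1 + t) * ‖ξ‖) ^ (-(1 : ℝ) / 2) * (1 + |Real.log ((1 + t) * ‖ξ‖)|) := by
  obtain ⟨J, hJ, hJeq⟩ := exists_differentiable_eq_besselJ_zero
  obtain ⟨S, hS, hSeq⟩ := exists_differentiable_eq_besselY0_series
  obtain ⟨M₁, hM₁⟩ := exists_norm_le_and_norm_deriv_le hJ R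
  obtain ⟨M₂, hM₂⟩ := exists_norm_le_and_norm_deriv_le hS R
  obtain ⟨M, hM, hM₁M, hM₂M⟩ : ∃ M : ℝ, 0 < M ∧ M₁ ≤ M ∧ M₂ ≤ M :=
    ⟨max 1 (max M₁ M₂), by positivity, by simp, by simp⟩
  refine ⟨M * (4 + 3 * R), by positivity, fun t ht ξ hξ hle => ?_⟩
  have hr : 0 < ‖ξ‖ := norm_pos_iff.2 hξ
  generalize ‖ξ‖ = r at hr hle
  have hτ : 0 < (1 + t) * r := by positivity
  have hnorm : ‖(((1 + t) * r : ℝ) : ℂ)‖ ≤ R := by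
    rwa [Complex.norm_real, Real.norm_of_nonneg hτ.le]
  obtain ⟨hJ₀, hJ₁⟩ := hM₁ _ hnorm
  obtain ⟨hS₀, hS₁⟩ := hM₂ _ hnorm
  replace hJ₀ := hJ₀.trans hM₁M
  replace hJ₁ := hJ₁.trans hM₁M
  replace hS₀ := hS₀.trans hM₂M
  replace hS₁ := hS₁.trans hM₂M
  have hJd : HasDerivAt (besselJ 0) (deriv J (((1 + t) * r : ℝ) : ℂ)) ((1 + t) * r) := by
    rw [funext hJeq]
    exact (hJ _).hasDerivAt.comp_ofReal
  have hYd := ((((hasDerivAt_log_half hτ).add_const (Real.eulerMascheroniConstant : ℂ)).const_mul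
    (2 / (π : ℂ))).mul hJd).add ((hS _).hasDerivAt.comp_ofReal.const_mul (2 / (π : ℂ)))
  replace hYd := hYd.congr_of_eventuallyEq (f₁ := besselY0) (.of_forall hSeq)
  have hJn : ‖besselJ 0 ((1 + t) * r)‖ ≤ M := by rw [hJeq]; exact hJ₀
  have hp := norm_two_div_pi_le_one
  have hlog := norm_log_half_add_eulerMascheroni_le hτ
  have hℓ : 0 ≤ |Real.log ((1 + t) * r)| := abs_nonneg _
  have hplus := norm_deriv_sqrt_mul_le (A := M) (B := R * M) hr hτ hJd hJn (by gcongr)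
  have hYn : ‖besselY0 ((1 + t) * r)‖ ≤ 3 * M * (1 + |Real.log ((1 + t) * r)|) := by
    rw [hSeq]
    refine (norm_add_le _ _).trans ?_
    simp only [norm_mul]
    calc _ ≤ 1 * (|Real.log ((1 + t) * r)| + 2) * M + 1 * M := by gcongr
      _ ≤ _ := by nlinarith
  have hminus := norm_deriv_sqrt_mul_le (A := 3 * M * (1 + |Real.log ((1 + t) * r)|))
    (B := M * (1 + 3 * R) * (1 + |Real.log ((1 + t) * r)|)) hr hτ hYd hYn (by
      have hinv : (1 + t) * r * ‖((((1 + t) * r : ℝ) : ℂ))⁻¹‖ = 1 := by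
        rw [norm_inv, Complex.norm_real, Real.norm_of_nonneg hτ.le, mul_inv_cancel₀ hτ.ne']
      generalize (1 + t) * r = τ at *
      calc _ ≤ τ * (‖(2 / (π : ℂ))‖ * ‖((τ : ℂ))⁻¹‖ * ‖besselJ 0 τ‖ +
            ‖(2 / (π : ℂ))‖ * ‖Complex.log ((τ : ℂ) / 2) + (Real.eulerMascheroniConstant : ℂ)‖ *
              ‖deriv J τ‖ + ‖(2 / (π : ℂ))‖ * ‖deriv S τ‖) := by
            gcongr
            refine (norm_add_le _ _).trans (add_le_add ((norm_add_le _ _).trans ?_) ?_) <;>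
              simp only [norm_mul, le_refl]
        _ ≤ τ * (1 * ‖((τ : ℂ))⁻¹‖ * M + 1 * (|Real.log τ| + 2) * M + 1 * M) := by gcongr
        _ = M + τ * ((|Real.log τ| + 3) * M) := by linear_combination M * hinv
        _ ≤ M + R * ((|Real.log τ| + 3) * M) := by gcongr
        _ ≤ _ := by nlinarith [mul_nonneg hM.le hℓ, mul_nonneg (mul_nonneg hM.le hℓ) hR.le])
  have hMR : 0 < M * R := mul_pos hM hR
  refine ⟨?_, ?_, hplus.trans ?_, hminus.trans (le_of_eq (by ring))⟩
  · rw [ePlus, norm_mul, Complex.norm_real, Real.norm_of_nonneg (Real.sqrt_nonneg _),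
      Real.sqrt_eq_rpow, mul_comm]
    gcongr
    linarith
  · rw [eMinusZ, norm_mul, Complex.norm_real, Real.norm_of_nonneg (Real.sqrt_nonneg _),
      Real.sqrt_eq_rpow, mul_comm, mul_right_comm]
    gcongr
    exact hYn.trans (mul_le_mul_of_nonneg_right (by linarith) (by linarith))
  · gcongr
    linarith

end
end
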